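/- arXiv:2009.13678 — 4 statements merged into one kernel-verified Lean document; each statement's English description precedes it below -/
import Mathlib

section
/- Let X have the Bernoulli-Gaussian distribution with density p₀δ₀(x) + (1 − p₀)p_G(x), let G be standard Gaussian independent of X, and let γ > 0, τ > 0. Then E[ |prox_{γ|·|}(X + τG)| ] = p₀ · 2τ ∫_{γ/τ}^{∞} (g − γ/τ) p_G(g) dg + (1 − p₀) · 2 ∫_{γ}^{∞} (z − γ) p_Z(z) dz, where p_Z is the density of the Gaussian distribution with mean 0 and variance 1 + τ². -/
open MeasureTheory ProbabilityTheory
open scoped ENNReal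

/-- Standard Gaussian probability density function. -/
noncomputable def pG (t : ℝ) : ℝ := (Real.sqrt (2 * Real.pi))⁻¹ * Real.exp (-t ^ 2 / 2)

/-- Density of the centered Gaussian with variance `1 + τ²`. -/
noncomputable def pZ (τ z : ℝ) : ℝ :=
  (Real.sqrt (2 * Real.pi * (1 + τ ^ 2)))⁻¹ * Real.exp (-z ^ 2 / (2 * (1 + τ ^ 2)))

/-- Soft thresholding: the proximity operator of `γ` times the absolute value,
`prox_{γ|·|}(q) = sign(q)·max(|q| − γ, 0)`. -/
noncomputable def softThresh (γ q : ℝ) : ℝ := Real.sign q * max (|q| - γ) 0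

/-- The Bernoulli-Gaussian distribution `p₀ δ₀ + (1 − p₀) N(0,1)` on `ℝ`. -/
noncomputable def bernoulliGaussian (p₀ : ℝ) : Measure ℝ :=
  ENNReal.ofReal p₀ • Measure.dirac (0 : ℝ)
    + ENNReal.ofReal (1 - p₀) • gaussianReal 0 1

lemma abs_softThresh {γ : ℝ} (hγ : 0 ≤ γ) (q : ℝ) : |softThresh γ q| = max (|q| - γ) 0 := by
  have hmax : 0 ≤ max (|q| - γ) 0 := le_max_right _ _
  unfold softThresh
  rcases lt_trichotomy q 0 with hq | rfl | hq
  · rw [Real.sign_of_neg hq, neg_one_mul, abs_neg, abs_of_nonneg hmax]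
  · simp [hγ]
  · rw [Real.sign_of_pos hq, one_mul, abs_of_nonneg hmax]

lemma abs_softThresh_mul {γ τ : ℝ} (hγ : 0 ≤ γ) (hτ : 0 < τ) (q : ℝ) :
    |softThresh γ (τ * q)| = τ * |softThresh (γ / τ) q| := by
  rw [abs_softThresh hγ, abs_softThresh (by positivity), mul_max_of_nonneg _ _ hτ.le, mul_sub,
    mul_div_cancel₀ _ hτ.ne', abs_mul, abs_of_pos hτ, mul_zero]

lemma continuous_abs_softThresh {γ : ℝ} (hγ : 0 ≤ γ) : Continuous fun q ↦ |softThresh γ q| := by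
  simp_rw [abs_softThresh hγ]
  fun_prop

lemma integrable_abs_softThresh_gaussianReal {γ : ℝ} (hγ : 0 ≤ γ) (m : ℝ) (v : NNReal) :
    Integrable (fun q ↦ |softThresh γ q|) (gaussianReal m v) := by
  have hid : Integrable id (gaussianReal m v) :=
    memLp_one_iff_integrable.mp (memLp_id_gaussianReal 1)
  refine hid.mono (continuous_abs_softThresh hγ).aestronglyMeasurable (.of_forall fun q ↦ ?_)
  rw [Real.norm_eq_abs, abs_abs, abs_softThresh hγ, id, Real.norm_eq_abs]
  exact max_le (by linarith) (abs_nonneg q)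

lemma integral_abs_softThresh_gaussianReal {γ : ℝ} (hγ : 0 ≤ γ) {v : NNReal} (hv : v ≠ 0) :
    ∫ q, |softThresh γ q| ∂(gaussianReal 0 v)
      = 2 * ∫ q in Set.Ioi γ, (q - γ) * gaussianPDFReal 0 v q := by
  rw [integral_gaussianReal_eq_integral_smul hv]
  have heven (q : ℝ) : gaussianPDFReal 0 v q • |softThresh γ q|
      = (fun r ↦ max (r - γ) 0 * gaussianPDFReal 0 v r) |q| := by
    simp [abs_softThresh hγ, gaussianPDFReal, mul_comm]
  simp_rw [heven]
  rw [integral_comp_abs (f := fun r ↦ max (r - γ) 0 * gaussianPDFReal 0 v r),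
    setIntegral_eq_of_subset_of_forall_sdiff_eq_zero (s := Set.Ioi γ) measurableSet_Ioi
      (Set.Ioi_subset_Ioi hγ)]
  · congr 1
    refine setIntegral_congr_fun measurableSet_Ioi fun q hq ↦ ?_
    have hq' : γ < q := hq
    simp only [max_eq_left (sub_nonneg.mpr hq'.le)]
  · intro q hq
    have hq' : q ≤ γ := not_lt.mp hq.2
    simp only [max_eq_right (sub_nonpos.mpr hq'), zero_mul]

lemma gaussianReal_prod_map_add_const_mul (τ : ℝ) :
    ((gaussianReal 0 1).prod (gaussianReal 0 1)).map (fun p : ℝ × ℝ ↦ p.1 + τ * p.2)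
      = gaussianReal 0 (1 + .mk (τ ^ 2) (sq_nonneg τ)) := by
  have h : (gaussianReal 0 1).prod (gaussianReal 0 (.mk (τ ^ 2) (sq_nonneg τ)))
      = ((gaussianReal 0 1).prod (gaussianReal 0 1)).map (Prod.map id (τ * ·)) := by
    rw [← Measure.map_prod_map _ _ measurable_id (measurable_const_mul τ), Measure.map_id,
      gaussianReal_map_const_mul, mul_zero, mul_one]
  have hconv := gaussianReal_conv_gaussianReal (m₁ := 0) (m₂ := 0) (v₁ := 1)
    (v₂ := .mk (τ ^ 2) (sq_nonneg τ))
  rw [Measure.conv, h, Measure.map_map (by fun_prop) (by fun_prop), add_zero] at hconv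
  exact hconv

lemma gaussianPDFReal_zero_one (t : ℝ) : gaussianPDFReal 0 1 t = pG t := by
  simp [gaussianPDFReal, pG]

lemma gaussianPDFReal_zero_one_add_sq (τ z : ℝ) :
    gaussianPDFReal 0 (1 + .mk (τ ^ 2) (sq_nonneg τ)) z = pZ τ z := by
  simp [gaussianPDFReal, pZ]

/-- for `X` Bernoulli-Gaussian, `G` independent standard
Gaussian, and `γ, τ > 0`,
`E[|prox_{γ|·|}(X + τG)|] = p₀·2τ∫_{γ/τ}^∞ (g − γ/τ) pG(g) dg
  + (1 − p₀)·2∫_γ^∞ (z − γ) pZ(z) dz`. -/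
theorem stmt_11 (p₀ γ τ : ℝ) (hp₀ : 0 ≤ p₀) (hp₁ : p₀ ≤ 1) (hγ : 0 < γ) (hτ : 0 < τ) :
    (∫ x, ∫ g, |softThresh γ (x + τ * g)| ∂(gaussianReal 0 1) ∂(bernoulliGaussian p₀))
      = p₀ * (2 * τ * ∫ g in Set.Ioi (γ / τ), (g - γ / τ) * pG g)
        + (1 - p₀) * (2 * ∫ z in Set.Ioi γ, (z - γ) * pZ τ z) := by
  have hint : Integrable (fun p : ℝ × ℝ ↦ |softThresh γ (p.1 + τ * p.2)|)
      ((gaussianReal 0 1).prod (gaussianReal 0 1)) := by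
    have h := integrable_abs_softThresh_gaussianReal hγ.le 0 (1 + .mk (τ ^ 2) (sq_nonneg τ))
    rw [← gaussianReal_prod_map_add_const_mul] at h
    exact h.comp_measurable (by fun_prop)
  have hcont : ∫ x, ∫ g, |softThresh γ (x + τ * g)| ∂(gaussianReal 0 1) ∂(gaussianReal 0 1)
      = 2 * ∫ z in Set.Ioi γ, (z - γ) * pZ τ z := by
    rw [integral_integral (f := fun x g ↦ |softThresh γ (x + τ * g)|) hint,
      ← integral_map (φ := fun p : ℝ × ℝ ↦ p.1 + τ * p.2) (f := fun q ↦ |softThresh γ q|)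
        (by fun_prop) (continuous_abs_softThresh hγ.le).aestronglyMeasurable,
      gaussianReal_prod_map_add_const_mul,
      integral_abs_softThresh_gaussianReal hγ.le (by positivity)]
    simp_rw [gaussianPDFReal_zero_one_add_sq]
  have hatom : ∫ g, |softThresh γ (0 + τ * g)| ∂(gaussianReal 0 1)
      = 2 * τ * ∫ g in Set.Ioi (γ / τ), (g - γ / τ) * pG g := by
    simp_rw [zero_add, abs_softThresh_mul hγ.le hτ]
    rw [integral_const_mul, integral_abs_softThresh_gaussianReal (by positivity) one_ne_zero]
    simp_rw [gaussianPDFReal_zero_one]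
    ring
  rw [bernoulliGaussian, integral_add_measure
      ((integrable_dirac (by simp)).smul_measure ENNReal.ofReal_ne_top)
      (hint.integral_prod_left.smul_measure ENNReal.ofReal_ne_top),
    integral_smul_measure, integral_smul_measure, integral_dirac, hcont, hatom,
    ENNReal.toReal_ofReal hp₀, ENNReal.toReal_ofReal (sub_nonneg.mpr hp₁), smul_eq_mul,
    smul_eq_mul]
end

section
/- Let X have the Bernoulli-Gaussian distribution with density p₀δ₀(x) + (1 − p₀)p_G(x), let G be standard Gaussian independent of X, and let γ > 0, τ > 0. Then E[ ( prox_{γ|·|}(X + τG) − (X + τG) )² ] = p₀ ( 2γ² ∫_{γ/τ}^{∞} p_G(g) dg + 2τ² ∫_0^{γ/τ} g² p_G(g) dg ) + (1 − p₀) ( 2γ² ∫_{γ}^{∞} p_Z(z) dz + 2 ∫_0^{γ} z² p_Z(z) dz ), where p_Z is the density of the Gaussian distribution with mean 0 and variance 1 + τ². -/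
open MeasureTheory ProbabilityTheory
open scoped ENNReal

lemma softThresh_sub_self_sq {γ : ℝ} (hγ : 0 ≤ γ) (q : ℝ) :
    (softThresh γ q - q) ^ 2 = (min |q| γ) ^ 2 := by
  unfold softThresh
  rcases lt_trichotomy q 0 with hq | rfl | hq
  · rw [Real.sign_of_neg hq, abs_of_neg hq]
    rcases le_total (-q) γ with h | h
    · rw [max_eq_right (by linarith), min_eq_left h]; ring
    · rw [max_eq_left (by linarith), min_eq_right h]; ring
  · simp [hγ]
  · rw [Real.sign_of_pos hq, abs_of_pos hq]
    rcases le_total q γ with h | h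
    · rw [max_eq_right (by linarith), min_eq_left h]; ring
    · rw [max_eq_left (by linarith), min_eq_right h]; ring

lemma min_abs_sq_le {c : ℝ} (hc : 0 ≤ c) (q : ℝ) : (min |q| c) ^ 2 ≤ c ^ 2 :=
  pow_le_pow_left₀ (le_min (abs_nonneg q) hc) (min_le_right _ _) 2

lemma integrable_min_abs_sq {μ : Measure ℝ} [IsFiniteMeasure μ] {c : ℝ} (hc : 0 ≤ c) :
    Integrable (fun q : ℝ => (min |q| c) ^ 2) μ := by
  refine Integrable.of_bound (C := c ^ 2) (by fun_prop) (ae_of_all _ fun q => ?_)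
  rw [Real.norm_of_nonneg (sq_nonneg _)]
  exact min_abs_sq_le hc q

lemma integral_min_abs_sq_gaussianReal {v : NNReal} (hv : v ≠ 0) {c : ℝ} (hc : 0 ≤ c) :
    ∫ q, (min |q| c) ^ 2 ∂(gaussianReal 0 v)
      = 2 * c ^ 2 * (∫ z in Set.Ioi c, gaussianPDFReal 0 v z)
        + 2 * (∫ z in (0 : ℝ)..c, z ^ 2 * gaussianPDFReal 0 v z) := by
  have hint : Integrable (fun z => gaussianPDFReal 0 v z * (min z c) ^ 2)
      (volume.restrict (Set.Ioi 0)) := by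
    refine ((integrable_gaussianPDFReal 0 v).restrict).mul_bdd (c := c ^ 2) (by fun_prop) ?_
    filter_upwards [ae_restrict_mem measurableSet_Ioi] with z hz
    rw [Real.norm_of_nonneg (sq_nonneg _)]
    simpa [abs_of_pos (Set.mem_Ioi.1 hz)] using min_abs_sq_le hc z
  have heven : ∀ z, gaussianPDFReal 0 v z = gaussianPDFReal 0 v |z| := fun z => by
    simp [gaussianPDFReal]
  rw [integral_gaussianReal_eq_integral_smul hv]
  calc ∫ z, gaussianPDFReal 0 v z • (min |z| c) ^ 2
      = ∫ z, (fun t => gaussianPDFReal 0 v t * (min t c) ^ 2) |z| :=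
        integral_congr_ae (ae_of_all _ fun z => by simp [← heven z])
    _ = 2 * ∫ z in Set.Ioi 0, gaussianPDFReal 0 v z * (min z c) ^ 2 :=
        integral_comp_abs (f := fun t => gaussianPDFReal 0 v t * (min t c) ^ 2)
    _ = 2 * ((∫ z in Set.Ioc 0 c, gaussianPDFReal 0 v z * (min z c) ^ 2)
          + ∫ z in Set.Ioi c, gaussianPDFReal 0 v z * (min z c) ^ 2) := by
        rw [← Set.Ioc_union_Ioi_eq_Ioi hc] at hint ⊢
        rw [setIntegral_union (Set.Ioc_disjoint_Ioi le_rfl) measurableSet_Ioi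
          (IntegrableOn.mono_set hint Set.subset_union_left)
          (IntegrableOn.mono_set hint Set.subset_union_right)]
    _ = _ := by
        rw [intervalIntegral.integral_of_le hc,
          setIntegral_congr_fun (g := fun z => z ^ 2 * gaussianPDFReal 0 v z) measurableSet_Ioc
            (fun z hz => by simp only [min_eq_left hz.2]; ring),
          setIntegral_congr_fun (g := fun z => c ^ 2 * gaussianPDFReal 0 v z) measurableSet_Ioi
            (fun z hz => by simp only [min_eq_right (le_of_lt (Set.mem_Ioi.1 hz))]; ring),
          integral_const_mul]
        ring

lemma gaussianPDFReal_zero_one_eq_pG : gaussianPDFReal 0 1 = pG := by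
  ext t
  simp [gaussianPDFReal, pG]

lemma gaussianPDFReal_zero_one_add_sq_eq_pZ (τ : ℝ) :
    gaussianPDFReal 0 (1 + NNReal.mk (τ ^ 2) (sq_nonneg τ)) = pZ τ := by
  ext z
  simp only [gaussianPDFReal, pZ, NNReal.coe_add, NNReal.coe_one, NNReal.coe_mk, sub_zero]

lemma integral_min_abs_mul_sq_gaussianReal {γ τ : ℝ} (hγ : 0 ≤ γ) (hτ : 0 < τ) :
    ∫ g, (min |τ * g| γ) ^ 2 ∂(gaussianReal 0 1)
      = 2 * γ ^ 2 * (∫ g in Set.Ioi (γ / τ), pG g)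
        + 2 * τ ^ 2 * (∫ g in (0 : ℝ)..(γ / τ), g ^ 2 * pG g) := by
  have hscale : ∀ g, (min |τ * g| γ) ^ 2 = τ ^ 2 * (min |g| (γ / τ)) ^ 2 := fun g => by
    rw [← mul_pow, mul_min_of_nonneg _ _ hτ.le, mul_div_cancel₀ _ hτ.ne', abs_mul, abs_of_pos hτ]
  simp_rw [hscale]
  rw [integral_const_mul, integral_min_abs_sq_gaussianReal one_ne_zero (div_nonneg hγ hτ.le),
    gaussianPDFReal_zero_one_eq_pG]
  field_simp

lemma integral_integral_min_abs_add_mul_sq_gaussianReal {γ : ℝ} (hγ : 0 ≤ γ) (τ : ℝ) :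
    ∫ x, ∫ g, (min |x + τ * g| γ) ^ 2 ∂(gaussianReal 0 1) ∂(gaussianReal 0 1)
      = 2 * γ ^ 2 * (∫ z in Set.Ioi γ, pZ τ z)
        + 2 * (∫ z in (0 : ℝ)..γ, z ^ 2 * pZ τ z) := by
  have hmap : (gaussianReal 0 1).map (τ * ·) = gaussianReal 0 (NNReal.mk (τ ^ 2) (sq_nonneg τ)) := by
    rw [gaussianReal_map_const_mul]
    simp
  have hinner : ∀ x, ∫ g, (min |x + τ * g| γ) ^ 2 ∂(gaussianReal 0 1)
      = ∫ y, (min |x + y| γ) ^ 2 ∂(gaussianReal 0 (NNReal.mk (τ ^ 2) (sq_nonneg τ))) := fun x => by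
    rw [← hmap, integral_map (by fun_prop) (by fun_prop)]
  simp_rw [hinner]
  rw [← integral_conv (f := fun q => (min |q| γ) ^ 2) (integrable_min_abs_sq hγ),
    gaussianReal_conv_gaussianReal, add_zero,
    integral_min_abs_sq_gaussianReal (by positivity) hγ, gaussianPDFReal_zero_one_add_sq_eq_pZ]

/-- for `X` Bernoulli-Gaussian, `G` independent standard
Gaussian, and `γ, τ > 0`,
`E[(prox_{γ|·|}(X + τG) − (X + τG))²]
  = p₀ (2γ²∫_{γ/τ}^∞ pG + 2τ²∫_0^{γ/τ} g² pG)
  + (1 − p₀)(2γ²∫_γ^∞ pZ + 2∫_0^γ z² pZ)`. -/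
theorem stmt_12 (p₀ γ τ : ℝ) (hp₀ : 0 ≤ p₀) (hp₁ : p₀ ≤ 1) (hγ : 0 < γ) (hτ : 0 < τ) :
    (∫ x, ∫ g, (softThresh γ (x + τ * g) - (x + τ * g)) ^ 2
        ∂(gaussianReal 0 1) ∂(bernoulliGaussian p₀))
      = p₀ * (2 * γ ^ 2 * (∫ g in Set.Ioi (γ / τ), pG g)
            + 2 * τ ^ 2 * (∫ g in (0 : ℝ)..(γ / τ), g ^ 2 * pG g))
        + (1 - p₀) * (2 * γ ^ 2 * (∫ z in Set.Ioi γ, pZ τ z)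
            + 2 * (∫ z in (0 : ℝ)..γ, z ^ 2 * pZ τ z)) := by
  simp_rw [softThresh_sub_self_sq hγ.le]
  have hint : ∀ μ : Measure ℝ, IsFiniteMeasure μ →
      Integrable (fun x => ∫ g, (min |x + τ * g| γ) ^ 2 ∂(gaussianReal 0 1)) μ := by
    intro μ _
    have hprod : Integrable (fun p : ℝ × ℝ => (min |p.1 + τ * p.2| γ) ^ 2)
        (μ.prod (gaussianReal 0 1)) := by
      refine Integrable.of_bound (C := γ ^ 2) (by fun_prop) (ae_of_all _ fun p => ?_)
      rw [Real.norm_of_nonneg (sq_nonneg _)]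
      exact min_abs_sq_le hγ.le _
    exact hprod.integral_prod_left
  rw [bernoulliGaussian, integral_add_measure
      ((hint _ inferInstance).smul_measure ENNReal.ofReal_ne_top)
      ((hint _ inferInstance).smul_measure ENNReal.ofReal_ne_top),
    integral_smul_measure, integral_smul_measure, integral_dirac,
    integral_integral_min_abs_add_mul_sq_gaussianReal hγ.le τ,
    ENNReal.toReal_ofReal hp₀, ENNReal.toReal_ofReal (sub_nonneg.2 hp₁)]
  simp only [zero_add, integral_min_abs_mul_sq_gaussianReal hγ.le hτ, smul_eq_mul]
end

section
/- Let X be a Bernoulli random variable with P(X = 0) = p₀ and P(X = 1) = 1 − p₀, let G be standard Gaussian independent of X, and let γ > 0, τ > 0. Then E[ ( prox_{γ|·|}(X + τG) − (X + τG) )² ] = p₀ ( 2γ² ∫_{γ/τ}^{∞} p_G(g) dg + 2τ² ∫_0^{γ/τ} g² p_G(g) dg ) + (1 − p₀) ( γ² ∫_{γ/τ − 1/τ}^{∞} p_G(g) dg + ∫_{−γ/τ − 1/τ}^{γ/τ − 1/τ} (1 + τg)² p_G(g) dg + γ² ∫_{−∞}^{−γ/τ − 1/τ} p_G(g) dg ).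 -/
open MeasureTheory ProbabilityTheory
open scoped ENNReal

/-- The Bernoulli distribution on `ℝ` with `P(X = 0) = p₀`, `P(X = 1) = 1 − p₀`. -/
noncomputable def bernoulliOnReal (p₀ : ℝ) : Measure ℝ :=
  ENNReal.ofReal p₀ • Measure.dirac (0 : ℝ)
    + ENNReal.ofReal (1 - p₀) • Measure.dirac (1 : ℝ)

lemma integrable_pG : Integrable pG :=
  gaussianPDFReal_zero_one_eq_pG ▸ integrable_gaussianPDFReal 0 1

lemma continuous_pG : Continuous pG := by
  unfold pG
  fun_prop

lemma pG_neg (t : ℝ) : pG (-t) = pG t := by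
  simp [pG]

/-- The squared residual of soft thresholding is `min(|q|, γ)²`. -/
lemma softThresh_sub_sq {γ : ℝ} (hγ : 0 < γ) (q : ℝ) :
    (softThresh γ q - q) ^ 2 = if |q| ≤ γ then q ^ 2 else γ ^ 2 := by
  unfold softThresh
  split_ifs with h
  · rw [max_eq_right (by linarith)]
    ring
  · rw [max_eq_left (by linarith)]
    rcases lt_trichotomy q 0 with hq | rfl | hq
    · rw [Real.sign_of_neg hq, abs_of_neg hq]
      ring
    · simp [hγ.le] at h
    · rw [Real.sign_of_pos hq, abs_of_pos hq]
      ring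

/-- The conditional expectation of the squared residual, given the value `x` of the signal. -/
lemma integral_softThresh_sub_sq_gaussianReal {γ τ : ℝ} (hγ : 0 < γ) (hτ : 0 < τ) (x : ℝ) :
    ∫ g, (softThresh γ (x + τ * g) - (x + τ * g)) ^ 2 ∂(gaussianReal 0 1)
      = γ ^ 2 * (∫ g in Set.Ioi (γ / τ - x / τ), pG g)
        + (∫ g in (-(γ / τ) - x / τ)..(γ / τ - x / τ), (x + τ * g) ^ 2 * pG g)
        + γ ^ 2 * (∫ g in Set.Iic (-(γ / τ) - x / τ), pG g) := by
  have hγτ : 0 < γ / τ := by positivity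
  set a := -(γ / τ) - x / τ with ha
  set b := γ / τ - x / τ with hb
  have hab : a ≤ b := by linarith
  have hτa : x + τ * a = -γ := by rw [ha]; field_simp; ring
  have hτb : x + τ * b = γ := by rw [hb]; field_simp; ring
  set f : ℝ → ℝ := fun g ↦ pG g * (softThresh γ (x + τ * g) - (x + τ * g)) ^ 2 with hf
  have f_lo : Set.EqOn f (fun g ↦ γ ^ 2 * pG g) (Set.Iio a) := by
    intro g (hg : g < a)
    have : τ * g < τ * a := by gcongr
    have hlt : ¬ |x + τ * g| ≤ γ := fun h ↦ by linarith [(abs_le.1 h).1]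
    simp only [hf, softThresh_sub_sq hγ, if_neg hlt, mul_comm]
  have f_mid : Set.EqOn f (fun g ↦ (x + τ * g) ^ 2 * pG g) (Set.Ioc a b) := by
    intro g ⟨hg₁, hg₂⟩
    have h₁ : τ * a < τ * g := by gcongr
    have h₂ : τ * g ≤ τ * b := by gcongr
    have hle : |x + τ * g| ≤ γ := abs_le.2 ⟨by linarith, by linarith⟩
    simp only [hf, softThresh_sub_sq hγ, if_pos hle, mul_comm]
  have f_hi : Set.EqOn f (fun g ↦ γ ^ 2 * pG g) (Set.Ioi b) := by
    intro g (hg : b < g)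
    have : τ * b < τ * g := by gcongr
    have hlt : ¬ |x + τ * g| ≤ γ := fun h ↦ by linarith [(abs_le.1 h).2]
    simp only [hf, softThresh_sub_sq hγ, if_neg hlt, mul_comm]
  have hpG : Integrable fun g ↦ γ ^ 2 * pG g := integrable_pG.const_mul _
  have int_lo : IntegrableOn f (Set.Iic a) :=
    (integrableOn_Iic_iff_integrableOn_Iio).2 (hpG.integrableOn.congr_fun f_lo.symm measurableSet_Iio)
  have int_mid : IntegrableOn f (Set.Ioc a b) := by
    refine IntegrableOn.congr_fun ?_ f_mid.symm measurableSet_Ioc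
    have := continuous_pG
    exact (Continuous.integrableOn_Icc (by fun_prop)).mono_set Set.Ioc_subset_Icc_self
  have int_hi : IntegrableOn f (Set.Ioi b) :=
    hpG.integrableOn.congr_fun f_hi.symm measurableSet_Ioi
  have int_Ioi : IntegrableOn f (Set.Ioi a) := by
    rw [← Set.Ioc_union_Ioi_eq_Ioi hab]
    exact int_mid.union int_hi
  rw [integral_gaussianReal_eq_integral_smul one_ne_zero, gaussianPDFReal_zero_one_eq_pG]
  simp only [smul_eq_mul]
  change ∫ g, f g = _
  rw [← intervalIntegral.integral_Iic_add_Ioi int_lo int_Ioi, ← Set.Ioc_union_Ioi_eq_Ioi hab,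
    setIntegral_union (Set.Ioc_disjoint_Ioi le_rfl) measurableSet_Ioi int_mid int_hi,
    integral_Iic_eq_integral_Iio, setIntegral_congr_fun measurableSet_Iio f_lo,
    setIntegral_congr_fun measurableSet_Ioc f_mid, setIntegral_congr_fun measurableSet_Ioi f_hi,
    ← integral_Iic_eq_integral_Iio, integral_const_mul, integral_const_mul,
    intervalIntegral.integral_of_le hab]
  ring

lemma integral_Iic_neg_pG (c : ℝ) : ∫ g in Set.Iic (-c), pG g = ∫ g in Set.Ioi c, pG g := by
  simpa only [pG_neg, neg_neg] using integral_comp_neg_Iic (-c) pG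

lemma integral_neg_self_sq_mul_pG (c : ℝ) :
    ∫ g in (-c)..c, g ^ 2 * pG g = 2 * ∫ g in (0 : ℝ)..c, g ^ 2 * pG g := by
  have hcont : Continuous fun g : ℝ ↦ g ^ 2 * pG g := by
    have := continuous_pG
    fun_prop
  have hneg : ∫ g in (-c)..0, g ^ 2 * pG g = ∫ g in (0 : ℝ)..c, g ^ 2 * pG g := by
    simpa only [pG_neg, neg_sq, neg_zero] using
      (intervalIntegral.integral_comp_neg (E := ℝ) (a := 0) (b := c)
        fun g ↦ g ^ (2 : ℕ) * pG g).symm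
  rw [← intervalIntegral.integral_add_adjacent_intervals (hcont.intervalIntegrable (-c) 0)
    (hcont.intervalIntegrable 0 c), hneg]
  ring

lemma integral_bernoulliOnReal {p₀ : ℝ} (hp₀ : 0 ≤ p₀) (hp₁ : p₀ ≤ 1) (f : ℝ → ℝ) :
    ∫ x, f x ∂(bernoulliOnReal p₀) = p₀ * f 0 + (1 - p₀) * f 1 := by
  have hint (c y : ℝ) : Integrable f (ENNReal.ofReal c • Measure.dirac y) :=
    (integrable_dirac (by simp)).smul_measure ENNReal.ofReal_ne_top
  rw [bernoulliOnReal, integral_add_measure (hint _ _) (hint _ _)]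
  simp [integral_smul_measure, hp₀, hp₁]

/-- for `X` Bernoulli (`P(X=0)=p₀`, `P(X=1)=1−p₀`), `G`
independent standard Gaussian, and `γ, τ > 0`,
`E[(prox_{γ|·|}(X + τG) − (X + τG))²]
  = p₀ (2γ²∫_{γ/τ}^∞ pG + 2τ²∫_0^{γ/τ} g² pG)
  + (1 − p₀)(γ²∫_{γ/τ−1/τ}^∞ pG + ∫_{−γ/τ−1/τ}^{γ/τ−1/τ} (1+τg)² pG
      + γ²∫_{−∞}^{−γ/τ−1/τ} pG)`. -/
theorem stmt_14 (p₀ γ τ : ℝ) (hp₀ : 0 ≤ p₀) (hp₁ : p₀ ≤ 1) (hγ : 0 < γ) (hτ : 0 < τ) :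
    (∫ x, ∫ g, (softThresh γ (x + τ * g) - (x + τ * g)) ^ 2
        ∂(gaussianReal 0 1) ∂(bernoulliOnReal p₀))
      = p₀ * (2 * γ ^ 2 * (∫ g in Set.Ioi (γ / τ), pG g)
            + 2 * τ ^ 2 * (∫ g in (0 : ℝ)..(γ / τ), g ^ 2 * pG g))
        + (1 - p₀) * (γ ^ 2 * (∫ g in Set.Ioi (γ / τ - 1 / τ), pG g)
            + (∫ g in (-(γ / τ) - 1 / τ)..(γ / τ - 1 / τ), (1 + τ * g) ^ 2 * pG g)
            + γ ^ 2 * (∫ g in Set.Iic (-(γ / τ) - 1 / τ), pG g)) := by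
  rw [integral_bernoulliOnReal hp₀ hp₁, integral_softThresh_sub_sq_gaussianReal hγ hτ,
    integral_softThresh_sub_sq_gaussianReal hγ hτ]
  simp only [zero_div, sub_zero, zero_add, mul_pow, mul_assoc, integral_Iic_neg_pG,
    intervalIntegral.integral_const_mul, integral_neg_self_sq_mul_pG]
  ring
end

section
/- Let f_n: ℝ^d → ℝ be a sequence of convex functions converging pointwise to a convex function f: ℝ^d → ℝ that has a unique global minimizer x*. If for each n the function f_n attains a global minimum at some point x_n, then x_n → x* and min f_n → f(x*) as n → ∞. -/
open Filter Topology

section PointwiseLimit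

variable {E : Type*} [NormedAddCommGroup E] [NormedSpace ℝ E] [FiniteDimensional ℝ E]
  {f : ℕ → E → ℝ} {g : E → ℝ}

/-- A pointwise limit of convex functions bounds them from above, locally uniformly. -/
lemma eventually_prod_lt_of_convexOn_of_tendsto (hf : ∀ n, ConvexOn ℝ Set.univ (f n))
    (hg : ConvexOn ℝ Set.univ g) (hfg : ∀ x, Tendsto (fun n => f n x) atTop (𝓝 (g x)))
    {y : E} {c : ℝ} (hc : g y < c) : ∀ᶠ p : ℕ × E in atTop ×ˢ 𝓝 y, f p.1 p.2 < c := by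
  have hs : {z | g z < c} ∈ 𝓝 y :=
    hg.locallyLipschitz.continuous.continuousAt.eventually_lt_const hc
  obtain ⟨b, hyb, hb⟩ := exists_mem_interior_convexHull_affineBasis hs
  have hvert : ∀ᶠ n in atTop, ∀ i, f n (b i) < c := eventually_all.2 fun i =>
    (hfg (b i)).eventually_lt_const (hb (subset_convexHull ℝ _ (Set.mem_range_self i)))
  filter_upwards [hvert.prod_mk (mem_interior_iff_mem_nhds.1 hyb)] with p hp
  have hsub : convexHull ℝ (Set.range b) ⊆ {x ∈ Set.univ | f p.1 x < c} :=
    convexHull_min (by rintro _ ⟨i, rfl⟩; exact ⟨trivial, hp.1 i⟩) ((hf p.1).convex_lt c)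
  exact (hsub hp.2).2

/-- A pointwise limit of convex functions bounds them from below, locally uniformly. -/
lemma eventually_prod_gt_of_convexOn_of_tendsto (hf : ∀ n, ConvexOn ℝ Set.univ (f n))
    (hg : ConvexOn ℝ Set.univ g) (hfg : ∀ x, Tendsto (fun n => f n x) atTop (𝓝 (g x)))
    {y : E} {c : ℝ} (hc : c < g y) : ∀ᶠ p : ℕ × E in atTop ×ˢ 𝓝 y, c < f p.1 p.2 := by
  have hrefl : Tendsto (fun z : E => (2 : ℝ) • y - z) (𝓝 y) (𝓝 y) := by
    have h : Continuous fun z : E => (2 : ℝ) • y - z := by fun_prop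
    simpa [two_smul] using h.tendsto y
  have hupper := (tendsto_id.prodMap hrefl).eventually <|
    eventually_prod_lt_of_convexOn_of_tendsto hf hg hfg
      (show g y < g y + (g y - c) / 3 by linarith)
  have hcenter : ∀ᶠ n in atTop, g y - (g y - c) / 3 < f n y :=
    (hfg y).eventually_const_lt (by linarith)
  filter_upwards [hupper, hcenter.prod_inl (𝓝 y)] with p hp hn
  have hmid := (hf p.1).2 (Set.mem_univ p.2) (Set.mem_univ ((2 : ℝ) • y - p.2))
    (by norm_num : (0 : ℝ) ≤ 1 / 2) (by norm_num : (0 : ℝ) ≤ 1 / 2) (by norm_num)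
  have hy : (1 / 2 : ℝ) • p.2 + (1 / 2 : ℝ) • ((2 : ℝ) • y - p.2) = y := by module
  rw [hy] at hmid
  simp only [smul_eq_mul, Prod.map_fst, Prod.map_snd, id] at hmid hp
  linarith

/-- Minimizers of convex functions converge to the unique minimizer of a convex pointwise limit. -/
lemma tendsto_minimizer_of_convexOn_of_tendsto (hf : ∀ n, ConvexOn ℝ Set.univ (f n))
    (hg : ConvexOn ℝ Set.univ g) (hfg : ∀ x, Tendsto (fun n => f n x) atTop (𝓝 (g x)))
    {a : E} (ha : ∀ x, x ≠ a → g a < g x) {u : ℕ → E} (hu : ∀ n x, f n (u n) ≤ f n x) :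
    Tendsto u atTop (𝓝 a) := by
  refine Metric.tendsto_nhds.2 fun r hr => ?_
  have hsphere : ∀ᶠ n in atTop, ∀ z ∈ Metric.sphere a r, f n a < f n z := by
    suffices h : ∀ᶠ p : ℕ × E in atTop ×ˢ 𝓝ˢ (Metric.sphere a r), f p.1 a < f p.1 p.2 from
      h.curry.mono fun _ hn => hn.self_of_nhdsSet
    simp only [(isCompact_sphere a r).prod_nhdsSet_eq_biSup, eventually_iSup]
    intro y hy
    obtain ⟨c, hac, hcy⟩ := exists_between (ha y (Metric.ne_of_mem_sphere hy hr.ne'))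
    filter_upwards [eventually_prod_gt_of_convexOn_of_tendsto hf hg hfg hcy,
      ((hfg a).eventually_lt_const hac).prod_inl (𝓝 y)] with p hp hn
    exact hn.trans hp
  filter_upwards [hsphere] with n hn
  by_contra! hdist
  have hpos : 0 < dist (u n) a := hr.trans_le hdist
  have ht0 : 0 ≤ r / dist (u n) a := by positivity
  have ht1 : r / dist (u n) a ≤ 1 := (div_le_one hpos).2 hdist
  have hz : AffineMap.lineMap a (u n) (r / dist (u n) a) ∈ Metric.sphere a r := by
    rw [Metric.mem_sphere, dist_lineMap_left, Real.norm_of_nonneg ht0, dist_comm a]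
    exact div_mul_cancel₀ r hpos.ne'
  have hseg : AffineMap.lineMap a (u n) (r / dist (u n) a) ∈ segment ℝ a (u n) := by
    rw [segment_eq_image_lineMap]
    exact ⟨_, ⟨ht0, ht1⟩, rfl⟩
  have hle := (hf n).le_on_segment (Set.mem_univ _) (Set.mem_univ _) hseg
  rw [max_eq_left (hu n a)] at hle
  exact (hn _ hz).not_ge hle

end PointwiseLimit

/-- if convex functions `f n : ℝ^d → ℝ` converge pointwise to a
convex function `f` with a unique global minimizer `x*`, and each `f n` attains
a global minimum at `x n`, then `x n → x*` and `min f n → f x*`. -/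
theorem stmt_16 (d : ℕ) (f : ℕ → (Fin d → ℝ) → ℝ) (flim : (Fin d → ℝ) → ℝ)
    (hfconv : ∀ n, ConvexOn ℝ Set.univ (f n))
    (hflimconv : ConvexOn ℝ Set.univ flim)
    (hpt : ∀ x : Fin d → ℝ, Tendsto (fun n => f n x) atTop (𝓝 (flim x)))
    (xstar : Fin d → ℝ)
    (hmin : ∀ x : Fin d → ℝ, flim xstar ≤ flim x)
    (huniq : ∀ x : Fin d → ℝ, (∀ y, flim x ≤ flim y) → x = xstar)
    (xn : ℕ → (Fin d → ℝ))
    (hxn : ∀ n, ∀ x : Fin d → ℝ, f n (xn n) ≤ f n x) :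
    Tendsto xn atTop (𝓝 xstar) ∧
      Tendsto (fun n => f n (xn n)) atTop (𝓝 (flim xstar)) := by
  have hlt : ∀ x, x ≠ xstar → flim xstar < flim x := fun x hx =>
    (hmin x).lt_of_ne fun h => hx (huniq x fun y => h ▸ hmin y)
  have hlim := tendsto_minimizer_of_convexOn_of_tendsto hfconv hflimconv hpt hlt hxn
  refine ⟨hlim, tendsto_order.2 ⟨fun c hc => ?_, fun c hc => ?_⟩⟩
  · exact (tendsto_id.prodMk hlim).eventually
      (eventually_prod_gt_of_convexOn_of_tendsto hfconv hflimconv hpt hc)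
  · filter_upwards [(hpt xstar).eventually_lt_const hc] with n hn
    exact (hxn n xstar).trans_lt hn
end
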